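/- arXiv:math/0012062 — 8 statements merged into one kernel-verified Lean document; each statement's English description precedes it below -/
import Mathlib

section
/- Let n ≥ 1 and k ≥ 0 be integers. In the ring of Laurent polynomials ℤ[q,q⁻¹] one has the character identity Σ_{p=0}^{k} C(2n,p)·C(2n,k−p)·q^{2p−k} = Σ_{j=0}^{⌊k/2⌋} ε^n_{k,k−2j} · ( Σ_{i=0}^{k−2j} q^{(k−2j)−2i} ). (The left side is the weight-character of the k-th exterior power of 2n copies of the basic Sp(1)-representation V₁, the inner sum on the right is the character of the irreducible representation V_{k−2j}; this is the decomposition Λ^k(ℂ²⊗ℂ^{2n}) ≅ ⊕_j ε^n_{k,k−2j}·V_{k−2j} of the paper's Proposition giving the Sp(1)-decomposition of Λ^k T*M on a quaternionic 4n-manifold.) -/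
/-- Integer binomial coefficient: `binom a b = C(a,b)`, zero when `b < 0` or `b > a`. -/
def binom (a b : ℤ) : ℤ :=
  if 0 ≤ b ∧ b ≤ a then (a.toNat.choose b.toNat : ℤ) else 0

/-- The multiplicity `ε^n_{k,k-2j}` of the irreducible Sp(1)-representation of highest
weight `k - 2j` in `Λ^k(ℂ² ⊗ ℂ^{2n})`. -/
def eps (n k j : ℤ) : ℤ :=
  binom (2 * n) (k - j) * binom (2 * n) j -
    binom (2 * n) (k - j + 1) * binom (2 * n) (j - 1)

open LaurentPolynomial in
/-- The character of the irreducible `Sp(1)`-representation of highest weight `m`. -/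
noncomputable def irrCharacter (m : ℕ) : LaurentPolynomial ℤ :=
  ∑ i ∈ Finset.range (m + 1), T ((m : ℤ) - 2 * i)

open LaurentPolynomial in
theorem irrCharacter_add_two (m : ℕ) :
    irrCharacter (m + 2) = irrCharacter m + T ((m : ℤ) + 2) + T (-((m : ℤ) + 2)) := by
  unfold irrCharacter
  rw [Finset.sum_range_succ, Finset.sum_range_succ']
  have inner_sum :
      ∑ i ∈ Finset.range (m + 1), T (R := ℤ) (((m + 2 : ℕ) : ℤ) - 2 * ((i + 1 : ℕ) : ℤ)) =
      ∑ i ∈ Finset.range (m + 1), T ((m : ℤ) - 2 * i) :=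
    Finset.sum_congr rfl fun i _ => by congr 1; push_cast; ring
  rw [inner_sum]
  congr 2
  push_cast
  ring

open LaurentPolynomial in
/-- A symmetric weight character decomposes into irreducible characters, the multiplicities
being the successive differences of the weight multiplicities. -/
theorem sum_weights_eq_sum_irrCharacter (k : ℕ) (a : ℤ → ℤ) (ha : ∀ p, a (k - p) = a p) :
    ∑ p ∈ Finset.range (k + 1), LaurentPolynomial.C (a p) * T (2 * (p : ℤ) - k) =
      LaurentPolynomial.C (a (-1)) * irrCharacter k +
        ∑ j ∈ Finset.range (k / 2 + 1),
          LaurentPolynomial.C (a j - a (j - 1)) * irrCharacter (k - 2 * j) := by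
  induction k using Nat.twoStepInduction generalizing a with
  | zero => simp [irrCharacter]
  | one =>
    have h := ha 0
    norm_num at h
    simp [irrCharacter, Finset.sum_range_succ, h]
    ring
  | more k ih _ =>
    have h := ih (fun p => a (p + 1)) fun p => by
      rw [← ha (p + 1)]
      congr 1
      push_cast
      ring
    have top : a ((k : ℤ) + 2) = a 0 := by
      rw [← ha 0]
      simp
    rw [Finset.sum_range_succ, Finset.sum_range_succ',
      show (k + 2) / 2 + 1 = (k / 2 + 1) + 1 by omega, Finset.sum_range_succ' _ (k / 2 + 1)]
    have left_sum : ∑ p ∈ Finset.range (k + 1), LaurentPolynomial.C (a ((p + 1 : ℕ) : ℤ)) *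
          T (2 * ((p + 1 : ℕ) : ℤ) - ((k + 2 : ℕ) : ℤ)) =
        ∑ p ∈ Finset.range (k + 1), LaurentPolynomial.C (a ((p : ℤ) + 1)) * T (2 * (p : ℤ) - k) :=
      Finset.sum_congr rfl fun p _ => by
        push_cast
        congr 2
        ring
    have right_sum : ∑ j ∈ Finset.range (k / 2 + 1),
          LaurentPolynomial.C (a ((j + 1 : ℕ) : ℤ) - a (((j + 1 : ℕ) : ℤ) - 1)) *
            irrCharacter (k + 2 - 2 * (j + 1)) =
        ∑ j ∈ Finset.range (k / 2 + 1),
          LaurentPolynomial.C (a ((j : ℤ) + 1) - a ((j : ℤ) - 1 + 1)) *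
            irrCharacter (k - 2 * j) :=
      Finset.sum_congr rfl fun j _ => by
        rw [show k + 2 - 2 * (j + 1) = k - 2 * j by omega]
        push_cast
        simp
    rw [left_sum, h, right_sum, Nat.mul_zero, Nat.sub_zero, irrCharacter_add_two]
    push_cast
    rw [top, show 2 * ((k : ℤ) + 2) - (k + 2) = k + 2 by ring]
    simp only [zero_sub, map_sub]
    ring

open LaurentPolynomial in
/-- The weight-character identity expressing the Sp(1)-isotypic decomposition
`Λ^k(ℂ² ⊗ ℂ^{2n}) ≅ ⊕_j ε^n_{k,k-2j} · V_{k-2j}` in the ring `ℤ[q,q⁻¹]`. -/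
theorem character_decomposition (n k : ℕ) (hn : 1 ≤ n) :
    (∑ p ∈ Finset.range (k + 1),
        LaurentPolynomial.C (binom (2 * (n : ℤ)) (p : ℤ) * binom (2 * (n : ℤ)) ((k : ℤ) - p)) *
          T (2 * (p : ℤ) - k)) =
      ∑ j ∈ Finset.range (k / 2 + 1),
        LaurentPolynomial.C (eps (n : ℤ) (k : ℤ) (j : ℤ)) *
          ∑ i ∈ Finset.range (k - 2 * j + 1), T (((k : ℤ) - 2 * j) - 2 * i) := by
  have h := sum_weights_eq_sum_irrCharacter k
    (fun p => binom (2 * (n : ℤ)) p * binom (2 * (n : ℤ)) (k - p)) fun p => by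
      rw [sub_sub_cancel, mul_comm]
  have below : binom (2 * (n : ℤ)) (-1) = 0 := by simp [binom]
  rw [h, below, zero_mul, map_zero, zero_mul, zero_add]
  refine Finset.sum_congr rfl fun j hj => ?_
  have hjk : 2 * j ≤ k := by
    have := Finset.mem_range.mp hj
    omega
  congr 1
  · congr 1
    rw [eps, mul_comm, mul_comm (binom _ ((j : ℤ) - 1)), sub_sub_eq_add_sub,
      sub_add_eq_add_sub]
  · simp only [irrCharacter, Nat.cast_sub hjk]
    push_cast
    rfl
end

section
/- Let n ≥ 1 and 0 ≤ k be integers. Then Σ_{j=0}^{⌊k/2⌋} (k−2j+1) · ε^n_{k,k−2j} = C(4n,k). (This expresses that the total dimension of the Sp(1)-isotypic decomposition Λ^k(ℂ²⊗ℂ^{2n}) ≅ ⊕_j ε^n_{k,k−2j}·V_{k−2j}, where dim V_r = r+1, equals dim Λ^k ℂ^{4n}.) -/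
theorem binom_natCast (a b : ℕ) : binom a b = (a.choose b : ℤ) := by
  unfold binom
  split_ifs with h
  · simp
  · rw [Nat.choose_eq_zero_of_lt (by omega), Nat.cast_zero]

theorem binom_of_neg (a : ℤ) {b : ℤ} (hb : b < 0) : binom a b = 0 :=
  if_neg (by omega)

/-- Summation by parts against the weight `w - 2 j`. -/
theorem sum_range_weight_mul_sub (w : ℤ) (a e : ℕ → ℤ) (m : ℕ) (h0 : e 0 = a 0)
    (hs : ∀ j < m, e (j + 1) = a (j + 1) - a j) :
    ∑ j ∈ Finset.range (m + 1), (w - 2 * j + 1) * e j =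
      (w - 2 * m + 1) * a m + 2 * ∑ j ∈ Finset.range m, a j := by
  induction m with
  | zero => simp [h0]
  | succ m ih =>
    rw [Finset.sum_range_succ, ih fun j hj => hs j (by omega), hs m (by omega),
      Finset.sum_range_succ]
    push_cast
    ring

/-- Folding the sum of a sequence symmetric under `j ↦ k - j` onto its lower half. -/
theorem sum_range_succ_of_symm (k : ℕ) (a : ℕ → ℤ) (h : ∀ j ≤ k, a (k - j) = a j) :
    ∑ j ∈ Finset.range (k + 1), a j =
      (k - 2 * (k / 2 : ℕ) + 1) * a (k / 2) + 2 * ∑ j ∈ Finset.range (k / 2), a j := by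
  rcases Nat.even_or_odd' k with ⟨m, rfl | rfl⟩
  · have hm : 2 * m / 2 = m := by omega
    have hr : ∑ x ∈ Finset.range m, a (m + (x + 1)) = ∑ x ∈ Finset.range m, a x := by
      rw [← Finset.sum_range_reflect a m]
      refine Finset.sum_congr rfl fun x hx => ?_
      rw [Finset.mem_range] at hx
      rw [← h _ (by omega)]
      congr 1
      omega
    rw [hm, show 2 * m + 1 = m + (m + 1) by ring, Finset.sum_range_add,
      Finset.sum_range_succ', hr]
    push_cast
    ring_nf
  · have hm : (2 * m + 1) / 2 = m := by omega
    have hr : ∑ x ∈ Finset.range (m + 1), a (m + 1 + x) =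
        ∑ x ∈ Finset.range (m + 1), a x := by
      rw [← Finset.sum_range_reflect a (m + 1)]
      refine Finset.sum_congr rfl fun x hx => ?_
      rw [Finset.mem_range] at hx
      rw [← h _ (by omega)]
      congr 1
      omega
    rw [hm, show 2 * m + 1 + 1 = (m + 1) + (m + 1) by ring, Finset.sum_range_add, hr,
      Finset.sum_range_succ]
    push_cast
    ring

theorem eps_zero (n k : ℕ) :
    eps n k (0 : ℕ) = ((2 * n).choose 0 * (2 * n).choose k : ℕ) := by
  have h := binom_natCast (2 * n) k
  have h' := binom_natCast (2 * n) 0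
  push_cast at h h'
  simp [eps, h, h', binom_of_neg]

theorem eps_succ (n k j : ℕ) (hj : j + 1 ≤ k) :
    eps n k (j + 1 : ℕ) =
      ((2 * n).choose (j + 1) * (2 * n).choose (k - (j + 1)) : ℕ) -
        ((2 * n).choose j * (2 * n).choose (k - j) : ℕ) := by
  have hn : (2 * n : ℤ) = (2 * n : ℕ) := by push_cast; rfl
  have h1 : (k : ℤ) - (j + 1 : ℕ) = (k - (j + 1) : ℕ) := by omega
  have h2 : ((k - (j + 1) : ℕ) : ℤ) + 1 = (k - j : ℕ) := by omega
  have h3 : ((j + 1 : ℕ) : ℤ) - 1 = j := by omega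
  rw [eps, h1, h2, h3, hn]
  simp only [binom_natCast]
  push_cast
  ring

/-- The total dimension of the Sp(1)-isotypic decomposition of `Λ^k(ℂ² ⊗ ℂ^{2n})`
equals `dim Λ^k ℂ^{4n} = C(4n,k)`: here `dim V_{k-2j} = k - 2j + 1`. -/
theorem dimension_count (n k : ℕ) (hn : 1 ≤ n) :
    (∑ j ∈ Finset.range (k / 2 + 1),
        ((k : ℤ) - 2 * j + 1) * eps (n : ℤ) (k : ℤ) (j : ℤ)) =
      binom (4 * (n : ℤ)) (k : ℤ) := by
  rw [sum_range_weight_mul_sub (k : ℤ)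
      (fun j => ((2 * n).choose j * (2 * n).choose (k - j) : ℕ)) (fun j => eps n k j) (k / 2)
      (eps_zero n k) fun j hj => eps_succ n k j (by omega),
    ← sum_range_succ_of_symm k
      (fun j => ((2 * n).choose j * (2 * n).choose (k - j) : ℕ)) fun j hj => by
        rw [Nat.sub_sub_self hj, mul_comm],
    show (4 * n : ℤ) = (2 * n + 2 * n : ℕ) by push_cast; ring, binom_natCast,
    Nat.add_choose_eq, Finset.Nat.sum_antidiagonal_eq_sum_range_succ_mk, Nat.cast_sum]
end

section
/- Let V be a vector space over ℂ, r ≥ 0 an integer, and I, J, K linear endomorphisms of V with I∘I + J∘J + K∘K = −r(r+2)·id_V. Then for α = (α₀,α₁,α₂,α₃) ∈ V⁴ one has Ĉ(α) = −(r+1)(r+3)·α if and only if the four 'lie in' conditions hold: rα₀ − Iα₁ − Jα₂ − Kα₃ = 0, rα₁ + Iα₀ + Jα₃ − Kα₂ = 0, rα₂ − Iα₃ + Jα₀ + Kα₁ = 0, and rα₃ + Iα₂ − Jα₁ + Kα₀ = 0. (These are the paper's conditions for an element of V_r ⊗ ℍ₀ to lie in the V_{r+1}-isotypic component.) -/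
variable {V : Type*} [AddCommGroup V] [Module ℂ V]

/-- The action of `I` on `V ⊗ ℍ₀`, modelled on `V × V × V × V`:
`Î(α₀,α₁,α₂,α₃) = (Iα₀ − α₁, Iα₁ + α₀, Iα₂ − α₃, Iα₃ + α₂)`. -/
def Ihat (I : V →ₗ[ℂ] V) (α : V × V × V × V) : V × V × V × V :=
  (I α.1 - α.2.1, I α.2.1 + α.1, I α.2.2.1 - α.2.2.2, I α.2.2.2 + α.2.2.1)

/-- The action of `J` on `V ⊗ ℍ₀`:
`Ĵ(α₀,α₁,α₂,α₃) = (Jα₀ − α₂, Jα₁ + α₃, Jα₂ + α₀, Jα₃ − α₁)`. -/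
def Jhat (J : V →ₗ[ℂ] V) (α : V × V × V × V) : V × V × V × V :=
  (J α.1 - α.2.2.1, J α.2.1 + α.2.2.2, J α.2.2.1 + α.1, J α.2.2.2 - α.2.1)

/-- The action of `K` on `V ⊗ ℍ₀`:
`K̂(α₀,α₁,α₂,α₃) = (Kα₀ − α₃, Kα₁ − α₂, Kα₂ + α₁, Kα₃ + α₀)`. -/
def Khat (K : V →ₗ[ℂ] V) (α : V × V × V × V) : V × V × V × V :=
  (K α.1 - α.2.2.2, K α.2.1 - α.2.2.1, K α.2.2.1 + α.2.1, K α.2.2.2 + α.1)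

/-- The Casimir operator `Ĉ = Î∘Î + Ĵ∘Ĵ + K̂∘K̂` on `V ⊗ ℍ₀`. -/
def Chat (I J K : V →ₗ[ℂ] V) (α : V × V × V × V) : V × V × V × V :=
  Ihat I (Ihat I α) + Jhat J (Jhat J α) + Khat K (Khat K α)

/-- Lie-in conditions for an element of `V_r ⊗ ℍ₀` to lie in the `V_{r+1}`-isotypic
component: `Ĉ(α) = −(r+1)(r+3)·α` iff the four displayed equations hold. -/
theorem lie_in_higher (I J K : V →ₗ[ℂ] V) (r : ℕ)
    (hCas : ∀ v : V, I (I v) + J (J v) + K (K v) = (-((r : ℂ) * ((r : ℂ) + 2))) • v)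
    (α : V × V × V × V) :
    Chat I J K α = (-(((r : ℂ) + 1) * ((r : ℂ) + 3))) • α ↔
      ((r : ℂ) • α.1 - I α.2.1 - J α.2.2.1 - K α.2.2.2 = 0 ∧
        (r : ℂ) • α.2.1 + I α.1 + J α.2.2.2 - K α.2.2.1 = 0 ∧
        (r : ℂ) • α.2.2.1 - I α.2.2.2 + J α.1 + K α.2.1 = 0 ∧
        (r : ℂ) • α.2.2.2 + I α.2.2.1 - J α.2.1 + K α.1 = 0) := by
  obtain ⟨a, b, c, d⟩ := α
  have key : ∀ x y v : V, x - (-(((r : ℂ) + 1) * ((r : ℂ) + 3))) • v = (2 : ℂ) • y →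
      (x = (-(((r : ℂ) + 1) * ((r : ℂ) + 3))) • v ↔ y = 0) := by
    intro x y v h
    rw [← sub_eq_zero, h, smul_eq_zero_iff_right two_ne_zero]
  have hI : ∀ v : V, I (I v) = (-((r : ℂ) * ((r : ℂ) + 2))) • v - J (J v) - K (K v) := by
    intro v
    rw [← hCas v]
    abel
  simp only [Chat, Ihat, Jhat, Khat, Prod.mk_add_mk, Prod.smul_mk, Prod.mk.injEq,
    map_add, map_sub, hI]
  refine and_congr (key _ _ _ ?_) (and_congr (key _ _ _ ?_)
    (and_congr (key _ _ _ ?_) (key _ _ _ ?_))) <;> module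
end

section
/- Let V be a vector space over ℂ, r ≥ 0 an integer, and I, J, K linear endomorphisms of V with I∘I + J∘J + K∘K = −r(r+2)·id_V. Then for α = (α₀,α₁,α₂,α₃) ∈ V⁴ one has Ĉ(α) = −(r−1)(r+1)·α if and only if the four 'lie in' conditions hold: (r+2)α₀ + Iα₁ + Jα₂ + Kα₃ = 0, (r+2)α₁ − Iα₀ − Jα₃ + Kα₂ = 0, (r+2)α₂ + Iα₃ − Jα₀ − Kα₁ = 0, and (r+2)α₃ − Iα₂ + Jα₁ − Kα₀ = 0. (These are the paper's conditions for an element of V_r ⊗ ℍ₀ to lie in the V_{r−1}-isotypic component.) -/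
variable {V : Type*} [AddCommGroup V] [Module ℂ V]

/-- If `y` differs from `-(r - 1)(r + 1) • v` by `-2 • w`, then the two agree iff `w = 0`. -/
theorem eq_smul_iff_of_sub_two_smul (c : ℂ) {v w y s : V}
    (hs : s = (-(c * (c + 2))) • v)
    (hy : y = s - (3 : ℂ) • v - (2 : ℂ) • (w - (c + 2) • v)) :
    y = (-((c - 1) * (c + 1))) • v ↔ w = 0 := by
  have key : y - (-((c - 1) * (c + 1))) • v = (-2 : ℂ) • w := by
    rw [hy, hs]
    module
  rw [← sub_eq_zero, key, smul_eq_zero]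
  norm_num

/-- Lie-in conditions for an element of `V_r ⊗ ℍ₀` to lie in the `V_{r-1}`-isotypic
component: `Ĉ(α) = −(r−1)(r+1)·α` iff the four displayed equations hold. -/
theorem lie_in_lower (I J K : V →ₗ[ℂ] V) (r : ℕ)
    (hCas : ∀ v : V, I (I v) + J (J v) + K (K v) = (-((r : ℂ) * ((r : ℂ) + 2))) • v)
    (α : V × V × V × V) :
    Chat I J K α = (-(((r : ℂ) - 1) * ((r : ℂ) + 1))) • α ↔
      (((r : ℂ) + 2) • α.1 + I α.2.1 + J α.2.2.1 + K α.2.2.2 = 0 ∧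
        ((r : ℂ) + 2) • α.2.1 - I α.1 - J α.2.2.2 + K α.2.2.1 = 0 ∧
        ((r : ℂ) + 2) • α.2.2.1 + I α.2.2.2 - J α.1 - K α.2.1 = 0 ∧
        ((r : ℂ) + 2) • α.2.2.2 - I α.2.2.1 + J α.2.1 - K α.1 = 0) := by
  obtain ⟨a, b, c, d⟩ := α
  simp only [Chat, Ihat, Jhat, Khat, Prod.mk_add_mk, Prod.smul_mk, Prod.mk.injEq, map_add,
    map_sub]
  refine and_congr (eq_smul_iff_of_sub_two_smul (r : ℂ) (hCas a) ?_)
    (and_congr (eq_smul_iff_of_sub_two_smul (r : ℂ) (hCas b) ?_)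
      (and_congr (eq_smul_iff_of_sub_two_smul (r : ℂ) (hCas c) ?_)
        (eq_smul_iff_of_sub_two_smul (r : ℂ) (hCas d) ?_))) <;>
    module
end

section
/- Let V be a vector space over ℂ, r ≥ 0 an integer, and I, J, K linear endomorphisms of V satisfying the sp(1) commutation relations and with I∘I + J∘J + K∘K = −r(r+2)·id_V. For α ∈ V set u = (1/(2(r+1)))·( (r+2)α, −Iα, −Jα, −Kα ) and v = (1/(2(r+1)))·( rα, Iα, Jα, Kα ) in V⁴. Then (α,0,0,0) = u + v, Ĉ(u) = −(r+1)(r+3)·u, and Ĉ(v) = −(r−1)(r+1)·v. (This is the algebraic content of the paper's formula for the principal symbol of D': the component u is σ_{D'}(x,e⁰)(α), the projection of α∧e⁰ onto the weight-(r+1) component.) -/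
variable {V : Type*} [AddCommGroup V] [Module ℂ V]

/-- `Ĉ` commutes with scalars. -/
theorem Chat_smul (I J K : V →ₗ[ℂ] V) (c : ℂ) (w : V × V × V × V) :
    Chat I J K (c • w) = c • Chat I J K w := by
  simp only [Chat, Ihat, Jhat, Khat, Prod.ext_iff, Prod.fst_add, Prod.snd_add, Prod.smul_fst,
    Prod.smul_snd, map_add, map_sub, map_smul, smul_add, smul_sub, and_self]

/-- If the Casimir operator is `-a(a+2)`, then `(aα, Iα, Jα, Kα)` is an eigenvector of `Ĉ`
with eigenvalue `1 - a²`. -/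
theorem Chat_eigenvector (I J K : V →ₗ[ℂ] V) (a : ℂ)
    (hIJ : ∀ v : V, I (J v) - J (I v) = (2 : ℂ) • K v)
    (hJK : ∀ v : V, J (K v) - K (J v) = (2 : ℂ) • I v)
    (hKI : ∀ v : V, K (I v) - I (K v) = (2 : ℂ) • J v)
    (hCas : ∀ v : V, I (I v) + J (J v) + K (K v) = (-(a * (a + 2))) • v) (α : V) :
    Chat I J K (a • α, I α, J α, K α) = (1 - a ^ 2) • (a • α, I α, J α, K α) := by
  simp only [Chat, Ihat, Jhat, Khat, Prod.ext_iff, Prod.fst_add, Prod.snd_add, Prod.smul_fst,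
    Prod.smul_snd, map_add, map_sub, map_smul]
  refine ⟨?_, ?_, ?_, ?_⟩
  · linear_combination (norm := module) (a - 2) • hCas α
  · linear_combination (norm := module) hCas (I α) + (2 : ℂ) • hJK α
  · linear_combination (norm := module) hCas (J α) + (2 : ℂ) • hKI α
  · linear_combination (norm := module) hCas (K α) + (2 : ℂ) • hIJ α

/-- The principal symbol decomposition: `(α,0,0,0) = u + v` where
`u = σ_{D'}(x,e⁰)(α)` lies in the weight-`(r+1)` Casimir eigenspace and `v` in the
weight-`(r-1)` eigenspace of `Ĉ` on `V ⊗ ℍ₀`. -/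
theorem symbol_decomposition (I J K : V →ₗ[ℂ] V) (r : ℕ)
    (hIJ : ∀ v : V, I (J v) - J (I v) = (2 : ℂ) • K v)
    (hJK : ∀ v : V, J (K v) - K (J v) = (2 : ℂ) • I v)
    (hKI : ∀ v : V, K (I v) - I (K v) = (2 : ℂ) • J v)
    (hCas : ∀ v : V, I (I v) + J (J v) + K (K v) = (-((r : ℂ) * ((r : ℂ) + 2))) • v)
    (α : V) :
    (α, (0 : V), (0 : V), (0 : V)) =
        (1 / (2 * ((r : ℂ) + 1))) • ((((r : ℂ) + 2) • α, -I α, -J α, -K α) : V × V × V × V) +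
          (1 / (2 * ((r : ℂ) + 1))) • (((r : ℂ) • α, I α, J α, K α) : V × V × V × V) ∧
      Chat I J K
          ((1 / (2 * ((r : ℂ) + 1))) • ((((r : ℂ) + 2) • α, -I α, -J α, -K α) : V × V × V × V)) =
        (-(((r : ℂ) + 1) * ((r : ℂ) + 3))) •
          ((1 / (2 * ((r : ℂ) + 1))) • ((((r : ℂ) + 2) • α, -I α, -J α, -K α) : V × V × V × V)) ∧
      Chat I J K
          ((1 / (2 * ((r : ℂ) + 1))) • (((r : ℂ) • α, I α, J α, K α) : V × V × V × V)) =
        (-(((r : ℂ) - 1) * ((r : ℂ) + 1))) •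
          ((1 / (2 * ((r : ℂ) + 1))) • (((r : ℂ) • α, I α, J α, K α) : V × V × V × V)) := by
  have hr : (r : ℂ) + 1 ≠ 0 := Nat.cast_add_one_ne_zero r
  have hu : ((((r : ℂ) + 2) • α, -I α, -J α, -K α) : V × V × V × V) =
      (-1 : ℂ) • ((-((r : ℂ) + 2)) • α, I α, J α, K α) := by
    rw [neg_one_smul, Prod.neg_mk, Prod.neg_mk, Prod.neg_mk, neg_smul, neg_neg]
  refine ⟨?_, ?_, ?_⟩
  · simp only [Prod.ext_iff, Prod.fst_add, Prod.snd_add, Prod.smul_fst, Prod.smul_snd, smul_neg,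
      neg_add_cancel, and_self, and_true]
    match_scalars
    field_simp
    ring
  · rw [hu, Chat_smul, Chat_smul, Chat_eigenvector I J K _ hIJ hJK hKI _ α]
    · module
    · intro v
      rw [hCas]
      congr 1
      ring
  · rw [Chat_smul, Chat_eigenvector I J K _ hIJ hJK hKI hCas α]
    module
end

section
/- Let V be a vector space over ℂ, r ≥ 0 an integer, and I, J, K linear endomorphisms of V with I∘I + J∘J + K∘K = −r(r+2)·id_V. Then for β = (β₁,β₂,β₃) ∈ V³: (i) Ĉ(β) = −(r+2)(r+4)·β if and only if Jβ₃ − Kβ₂ = −rβ₁, Kβ₁ − Iβ₃ = −rβ₂, and Iβ₂ − Jβ₁ = −rβ₃; (ii) Ĉ(β) = −r(r+2)·β if and only if Jβ₃ − Kβ₂ = 2β₁, Kβ₁ − Iβ₃ = 2β₂, and Iβ₂ − Jβ₁ = 2β₃; (iii) Ĉ(β) = −(r−2)r·β if and only if Jβ₃ − Kβ₂ = (r+2)β₁, Kβ₁ − Iβ₃ = (r+2)β₂, and Iβ₂ − Jβ₁ = (r+2)β₃. (These are the lie-in conditions for an element of V_r ⊗ Λ²₊ℍ₀ ≅ V_r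 ⊗ V₂ to lie in the V_{r+2}-, V_r-, and V_{r−2}-isotypic components respectively.) -/
variable {V : Type*} [AddCommGroup V] [Module ℂ V]

/-- The action of `I` on `V ⊗ Λ²₊ℍ₀`, modelled on `V × V × V`:
`Î(β₁,β₂,β₃) = (Iβ₁, Iβ₂ − 2β₃, Iβ₃ + 2β₂)`. -/
def Ihat3 (I : V →ₗ[ℂ] V) (β : V × V × V) : V × V × V :=
  (I β.1, I β.2.1 - (2 : ℂ) • β.2.2, I β.2.2 + (2 : ℂ) • β.2.1)

/-- The action of `J` on `V ⊗ Λ²₊ℍ₀`: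
`Ĵ(β₁,β₂,β₃) = (Jβ₁ + 2β₃, Jβ₂, Jβ₃ − 2β₁)`. -/
def Jhat3 (J : V →ₗ[ℂ] V) (β : V × V × V) : V × V × V :=
  (J β.1 + (2 : ℂ) • β.2.2, J β.2.1, J β.2.2 - (2 : ℂ) • β.1)

/-- The action of `K` on `V ⊗ Λ²₊ℍ₀`:
`K̂(β₁,β₂,β₃) = (Kβ₁ − 2β₂, Kβ₂ + 2β₁, Kβ₃)`. -/
def Khat3 (K : V →ₗ[ℂ] V) (β : V × V × V) : V × V × V :=
  (K β.1 - (2 : ℂ) • β.2.1, K β.2.1 + (2 : ℂ) • β.1, K β.2.2)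

/-- The Casimir operator `Ĉ = Î∘Î + Ĵ∘Ĵ + K̂∘K̂` on `V ⊗ Λ²₊ℍ₀`. -/
def Chat3 (I J K : V →ₗ[ℂ] V) (β : V × V × V) : V × V × V :=
  Ihat3 I (Ihat3 I β) + Jhat3 J (Jhat3 J β) + Khat3 K (Khat3 K β)

/-- The Casimir operator on `V ⊗ Λ²₊ℍ₀` is that of `V` shifted by `-8`, plus four times the
curl of `β` with respect to `(I, J, K)`. -/
theorem Chat3_apply (I J K : V →ₗ[ℂ] V) (β : V × V × V) :
    Chat3 I J K β =
      (I (I β.1) + J (J β.1) + K (K β.1) - (8 : ℂ) • β.1 + (4 : ℂ) • (J β.2.2 - K β.2.1),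
        I (I β.2.1) + J (J β.2.1) + K (K β.2.1) - (8 : ℂ) • β.2.1 +
          (4 : ℂ) • (K β.1 - I β.2.2),
        I (I β.2.2) + J (J β.2.2) + K (K β.2.2) - (8 : ℂ) • β.2.2 +
          (4 : ℂ) • (I β.2.1 - J β.1)) := by
  simp only [Chat3, Ihat3, Jhat3, Khat3, Prod.mk_add_mk, map_add, map_sub, map_smul]
  ext <;> dsimp only <;> module

/-- If `V` has Casimir eigenvalue `c`, the eigenvectors of the Casimir operator of
`V ⊗ Λ²₊ℍ₀` with eigenvalue `c - 8 + 4d` are the eigenvectors of the curl with eigenvalue `d`. -/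
theorem Chat3_eq_smul_iff (I J K : V →ₗ[ℂ] V) {c e d : ℂ}
    (hCas : ∀ v : V, I (I v) + J (J v) + K (K v) = c • v) (he : e = c - 8 + 4 * d)
    (β : V × V × V) :
    Chat3 I J K β = e • β ↔
      (J β.2.2 - K β.2.1 = d • β.1 ∧ K β.1 - I β.2.2 = d • β.2.1 ∧
        I β.2.1 - J β.1 = d • β.2.2) := by
  have key (x y : V) : c • x - (8 : ℂ) • x + (4 : ℂ) • y = e • x ↔ y = d • x := by
    have he' : e • x = c • x - (8 : ℂ) • x + (4 : ℂ) • d • x := by rw [he]; module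
    rw [he', add_right_inj, smul_right_inj (by norm_num : (4 : ℂ) ≠ 0)]
  simp only [Chat3_apply, hCas, Prod.ext_iff, Prod.smul_fst, Prod.smul_snd, key]

/-- Lie-in conditions for an element of `V_r ⊗ Λ²₊ℍ₀ ≅ V_r ⊗ V₂` to lie in the
`V_{r+2}`-, `V_r`-, and `V_{r-2}`-isotypic components respectively. -/
theorem lie_in_selfdual (I J K : V →ₗ[ℂ] V) (r : ℕ)
    (hCas : ∀ v : V, I (I v) + J (J v) + K (K v) = (-((r : ℂ) * ((r : ℂ) + 2))) • v)
    (β : V × V × V) :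
    (Chat3 I J K β = (-(((r : ℂ) + 2) * ((r : ℂ) + 4))) • β ↔
        (J β.2.2 - K β.2.1 = (-(r : ℂ)) • β.1 ∧
          K β.1 - I β.2.2 = (-(r : ℂ)) • β.2.1 ∧
          I β.2.1 - J β.1 = (-(r : ℂ)) • β.2.2)) ∧
      (Chat3 I J K β = (-((r : ℂ) * ((r : ℂ) + 2))) • β ↔
        (J β.2.2 - K β.2.1 = (2 : ℂ) • β.1 ∧
          K β.1 - I β.2.2 = (2 : ℂ) • β.2.1 ∧
          I β.2.1 - J β.1 = (2 : ℂ) • β.2.2)) ∧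
      (Chat3 I J K β = (-(((r : ℂ) - 2) * (r : ℂ))) • β ↔
        (J β.2.2 - K β.2.1 = ((r : ℂ) + 2) • β.1 ∧
          K β.1 - I β.2.2 = ((r : ℂ) + 2) • β.2.1 ∧
          I β.2.1 - J β.1 = ((r : ℂ) + 2) • β.2.2)) :=
  ⟨Chat3_eq_smul_iff I J K hCas (by ring) β, Chat3_eq_smul_iff I J K hCas (by ring) β,
    Chat3_eq_smul_iff I J K hCas (by ring) β⟩
end

section
/- Let V be a vector space over ℂ and I, J, K linear endomorphisms of V satisfying the sp(1) commutation relations. For any β₀ ∈ V, the triple β = (β₁,β₂,β₃) = (Iβ₀, Jβ₀, Kβ₀) ∈ V³ satisfies Jβ₃ − Kβ₂ = 2β₁, Kβ₁ − Iβ₃ = 2β₂, and Iβ₂ − Jβ₁ = 2β₃. Moreover, if in addition I∘I + J∘J + K∘K = −r(r+2)·id_V for an integer r ≥ 0, then Ĉ(β) = −r(r+2)·β. (This is the paper's observation that all solutions of the middle lie-in condition arise from a single element β₀, used in proving exactness of the symbol sequence at E²_{k,r}.) -/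
variable {V : Type*} [AddCommGroup V] [Module ℂ V]

/-- Solutions of the middle lie-in condition arising from a single element `β₀`:
the triple `(Iβ₀, Jβ₀, Kβ₀)` satisfies the `V_r`-lie-in conditions, and if moreover
the Casimir of `V` equals `−r(r+2)·id`, it is a `Ĉ`-eigenvector with
eigenvalue `−r(r+2)`. -/
theorem middle_solutions (I J K : V →ₗ[ℂ] V)
    (hIJ : ∀ v : V, I (J v) - J (I v) = (2 : ℂ) • K v)
    (hJK : ∀ v : V, J (K v) - K (J v) = (2 : ℂ) • I v)
    (hKI : ∀ v : V, K (I v) - I (K v) = (2 : ℂ) • J v)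
    (β₀ : V) :
    (J (K β₀) - K (J β₀) = (2 : ℂ) • I β₀ ∧
        K (I β₀) - I (K β₀) = (2 : ℂ) • J β₀ ∧
        I (J β₀) - J (I β₀) = (2 : ℂ) • K β₀) ∧
      ∀ r : ℕ,
        (∀ v : V, I (I v) + J (J v) + K (K v) = (-((r : ℂ) * ((r : ℂ) + 2))) • v) →
          Chat3 I J K (I β₀, J β₀, K β₀) =
            (-((r : ℂ) * ((r : ℂ) + 2))) • ((I β₀, J β₀, K β₀) : V × V × V) := by
  refine ⟨⟨hJK β₀, hKI β₀, hIJ β₀⟩, fun r hC => ?_⟩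
  simp only [Chat3, Ihat3, Jhat3, Khat3, Prod.mk_add_mk, Prod.smul_mk, ← hC,
    map_add, map_sub, map_smul, Prod.mk.injEq]
  refine ⟨?_, ?_, ?_⟩
  · linear_combination (norm := module) (4 : ℂ) • hJK β₀
  · linear_combination (norm := module) (4 : ℂ) • hKI β₀
  · linear_combination (norm := module) (4 : ℂ) • hIJ β₀
end

section
/- Let V be a vector space over ℂ, let I, J, K be linear endomorphisms of V satisfying the sp(1) commutation relations, and let r ≥ 1 be an integer. Define linear maps T₀ : V → V⁴ by T₀(β) = (rβ, −Iβ, −Jβ, −Kβ) and T₁ : V⁴ → V⁶ by T₁(α₀,α₁,α₂,α₃) = ( rα₁ + Iα₀, rα₂ + Jα₀, rα₃ + Kα₀, 2α₁ − Jα₃ + Kα₂, 2α₂ − Kα₁ + Iα₃, 2α₃ − Iα₂ + Jα₁ ). Then T₁ ∘ T₀ = 0 and ker T₁ = range T₀; in particular T₁(α) = 0 if and only if α₁ = −(1/r)Iα₀, α₂ = −(1/r)Jα₀ and α₃ = −(1/r)Kα₀, in which case α = T₀(α₀/r). (This is the exactness, at the second space, of the principal symbol sequence E⁰_{k−2,r−2}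 → E¹_{k−1,r−1} → E²_{k,r} proved in the paper's exactness proposition, the key step in establishing ellipticity of the quaternionic double complex.) -/
variable {V : Type*} [AddCommGroup V] [Module ℂ V]

/-- The principal symbol (up to nonzero scalar) of the quaternionic Dolbeault operator
`D'` at `e⁰` from `E⁰_{k-2,r-2}` to `E¹_{k-1,r-1}`: `T₀(β) = (rβ, −Iβ, −Jβ, −Kβ)`. -/
def T0 (I J K : V →ₗ[ℂ] V) (r : ℕ) (β : V) : V × V × V × V :=
  ((r : ℂ) • β, -I β, -J β, -K β)

/-- The principal symbol (up to nonzero scalar) of `D'` at `e⁰` from `E¹_{k-1,r-1}`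
to `E²_{k,r}`, written in components. -/
def T1 (I J K : V →ₗ[ℂ] V) (r : ℕ) (α : V × V × V × V) : V × V × V × V × V × V :=
  ((r : ℂ) • α.2.1 + I α.1,
    (r : ℂ) • α.2.2.1 + J α.1,
    (r : ℂ) • α.2.2.2 + K α.1,
    (2 : ℂ) • α.2.1 - J α.2.2.2 + K α.2.2.1,
    (2 : ℂ) • α.2.2.1 - K α.2.1 + I α.2.2.2,
    (2 : ℂ) • α.2.2.2 - I α.2.2.1 + J α.2.1)

theorem T1_T0 (I J K : V →ₗ[ℂ] V) (r : ℕ)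
    (hIJ : ∀ v : V, I (J v) - J (I v) = (2 : ℂ) • K v)
    (hJK : ∀ v : V, J (K v) - K (J v) = (2 : ℂ) • I v)
    (hKI : ∀ v : V, K (I v) - I (K v) = (2 : ℂ) • J v) (β : V) :
    T1 I J K r (T0 I J K r β) = 0 := by
  simp only [T1, T0, map_neg, map_smul, smul_neg, ← hIJ, ← hJK, ← hKI, Prod.mk_eq_zero]
  refine ⟨?_, ?_, ?_, ?_, ?_, ?_⟩ <;> abel

theorem components_of_T1_eq_zero (I J K : V →ₗ[ℂ] V) {r : ℕ} (hr : (r : ℂ) ≠ 0)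
    {α : V × V × V × V} (h : T1 I J K r α = 0) :
    α.2.1 = (-(1 / (r : ℂ))) • I α.1 ∧
      α.2.2.1 = (-(1 / (r : ℂ))) • J α.1 ∧
      α.2.2.2 = (-(1 / (r : ℂ))) • K α.1 := by
  have key : ∀ x y : V, (r : ℂ) • x + y = 0 → x = (-(1 / (r : ℂ))) • y := by
    intro x y hxy
    rw [eq_neg_of_add_eq_zero_right hxy, neg_smul, smul_neg, neg_neg, smul_smul,
      one_div_mul_cancel hr, one_smul]
  simp only [T1, Prod.mk_eq_zero] at h
  exact ⟨key _ _ h.1, key _ _ h.2.1, key _ _ h.2.2.1⟩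

theorem eq_T0_of_components (I J K : V →ₗ[ℂ] V) {r : ℕ} (hr : (r : ℂ) ≠ 0)
    {α : V × V × V × V}
    (h : α.2.1 = (-(1 / (r : ℂ))) • I α.1 ∧
      α.2.2.1 = (-(1 / (r : ℂ))) • J α.1 ∧
      α.2.2.2 = (-(1 / (r : ℂ))) • K α.1) :
    α = T0 I J K r ((1 / (r : ℂ)) • α.1) := by
  obtain ⟨a, b, c, d⟩ := α
  dsimp only at h
  obtain ⟨rfl, rfl, rfl⟩ := h
  simp [T0, smul_smul, hr]

/-- Exactness of the principal symbol sequence `E⁰ → E¹ → E²` at the second space: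
`T₁ ∘ T₀ = 0` and `ker T₁ = range T₀`; explicitly, `T₁(α) = 0` iff
`α₁ = −(1/r)Iα₀`, `α₂ = −(1/r)Jα₀`, `α₃ = −(1/r)Kα₀`, in which case `α = T₀(α₀/r)`. -/
theorem symbol_sequence_exact (I J K : V →ₗ[ℂ] V) (r : ℕ) (hr : 1 ≤ r)
    (hIJ : ∀ v : V, I (J v) - J (I v) = (2 : ℂ) • K v)
    (hJK : ∀ v : V, J (K v) - K (J v) = (2 : ℂ) • I v)
    (hKI : ∀ v : V, K (I v) - I (K v) = (2 : ℂ) • J v) :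
    (∀ β : V, T1 I J K r (T0 I J K r β) = 0) ∧
      (∀ α : V × V × V × V, T1 I J K r α = 0 ↔ ∃ β : V, T0 I J K r β = α) ∧
      (∀ α : V × V × V × V, T1 I J K r α = 0 ↔
        (α.2.1 = (-(1 / (r : ℂ))) • I α.1 ∧
          α.2.2.1 = (-(1 / (r : ℂ))) • J α.1 ∧
          α.2.2.2 = (-(1 / (r : ℂ))) • K α.1)) ∧
      (∀ α : V × V × V × V, T1 I J K r α = 0 → α = T0 I J K r ((1 / (r : ℂ)) • α.1)) := by
  have hr0 : (r : ℂ) ≠ 0 := Nat.cast_ne_zero.mpr (Nat.one_le_iff_ne_zero.mp hr)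
  have comp := T1_T0 I J K r hIJ hJK hKI
  have ker_eq : ∀ α : V × V × V × V, T1 I J K r α = 0 →
      α = T0 I J K r ((1 / (r : ℂ)) • α.1) := fun α h =>
    eq_T0_of_components I J K hr0 (components_of_T1_eq_zero I J K hr0 h)
  refine ⟨comp, fun α => ⟨fun h => ⟨_, (ker_eq α h).symm⟩, ?_⟩,
    fun α => ⟨components_of_T1_eq_zero I J K hr0, fun h => ?_⟩, ker_eq⟩
  · rintro ⟨β, rfl⟩
    exact comp β
  · rw [eq_T0_of_components I J K hr0 h]
    exact comp _
end
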